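/- Let d ≥ 3, α = (d-2)/2, let P be a homogeneous polynomial of degree l on ℝ^d, and let f be a Schwartz function on ℝ. Then for every y ∈ ℝ^d, (2π)^{-d/2} ∫_{ℝ^d} f(|x|) P(x) e^{i(y|x)} dx = i^l Σ_{k=0}^{⌊l/2⌋} ((-1)^k / (2^k k!)) H_{α+l-k}(f)(|y|) · (Δ^k P)(y), where Δ^k P denotes the k-fold Laplacian of P. -/

import Mathlib

open MeasureTheory MvPolynomial Finset
open scoped RealInnerProductSpace SchwartzMap

noncomputable section

/-- The Euclidean Laplacian `Δ = Σ_{j=1}^d ∂²/∂x_j²` acting on polynomials on `ℝ^d`. -/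
def lap {d : ℕ} (P : MvPolynomial (Fin d) ℝ) : MvPolynomial (Fin d) ℝ :=
  ∑ i, pderiv i (pderiv i P)

/-- The spherical Bessel function
`j_ν(t) = Γ(ν+1)(t/2)^{-ν} J_ν(t) = Γ(ν+1) Σ_{k=0}^∞ (-1)^k/(Γ(k+1)Γ(k+ν+1)) (t/2)^{2k}`. -/
def sphericalBesselJ (ν t : ℝ) : ℝ :=
  Real.Gamma (ν + 1) *
    ∑' k : ℕ, (-1) ^ k / (Real.Gamma (k + 1) * Real.Gamma (k + ν + 1)) * (t / 2) ^ (2 * k)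

/-- The Hankel transform of order `ν`:
`H_ν(φ)(t) = (2^{-ν}/Γ(ν+1)) ∫_0^∞ φ(s) j_ν(st) s^{2ν+1} ds`. -/
def hankel (ν : ℝ) (φ : ℝ → ℝ) (t : ℝ) : ℝ :=
  (2 : ℝ) ^ (-ν) / Real.Gamma (ν + 1) *
    ∫ s in Set.Ioi (0 : ℝ), φ s * sphericalBesselJ ν (s * t) * s ^ (2 * ν + 1)


/-- The normalized Bessel series as an entire function of `q = t²`. -/
def Gs (ν q : ℝ) : ℝ :=
  ∑' k : ℕ, (-1) ^ k / (Real.Gamma (k + 1) * Real.Gamma (k + ν + 1)) * (q / 4) ^ k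

lemma sphericalBesselJ_eq (ν t : ℝ) :
    sphericalBesselJ ν t = Real.Gamma (ν + 1) * Gs ν (t ^ 2) := by
  unfold sphericalBesselJ Gs
  congr 2
  ext k
  rw [pow_mul]
  congr 2
  ring

lemma Gamma_lower (ν : ℝ) (hν : 0 ≤ ν) (k : ℕ) :
    Real.Gamma (ν + 1) ≤ Real.Gamma (k + ν + 1) := by
  induction k with
  | zero => simp
  | succ n ih =>
    refine ih.trans ?_
    have h : ((n + 1 : ℕ) : ℝ) + ν + 1 = (n + ν + 1) + 1 := by push_cast; ring
    rw [h, Real.Gamma_add_one (s := n + ν + 1) (by positivity)]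
    have := (Real.Gamma_pos_of_pos (s := n + ν + 1) (by positivity)).le
    have hn : (0:ℝ) ≤ n := by positivity
    nlinarith

lemma coeff_bound (ν : ℝ) (hν : 0 ≤ ν) (k : ℕ) :
    |(-1 : ℝ) ^ k / (Real.Gamma (k + 1) * Real.Gamma (k + ν + 1))| ≤
      (1 / Real.Gamma (ν + 1)) * (1 / (k.factorial : ℝ)) := by
  have h0 : 0 < Real.Gamma (ν + 1) := Real.Gamma_pos_of_pos (by positivity)
  have h1 := Gamma_lower ν hν k
  rw [Real.Gamma_nat_eq_factorial, abs_div, abs_pow, abs_neg, abs_one, one_pow,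
    abs_of_pos (by positivity), ← one_div_mul_one_div_rev, mul_comm]
  rw [mul_comm (1 / (k.factorial : ℝ))]
  gcongr

lemma summable_Gs (ν : ℝ) (hν : 0 ≤ ν) (q : ℝ) : Summable (fun k : ℕ =>
    (-1 : ℝ) ^ k / (Real.Gamma (k + 1) * Real.Gamma (k + ν + 1)) * (q / 4) ^ k) := by
  have := (Real.summable_pow_div_factorial |q / 4|).mul_left (1 / Real.Gamma (ν + 1))
  refine Summable.of_norm_bounded this (fun k => ?_)
  rw [Real.norm_eq_abs, abs_mul, abs_pow]
  have := coeff_bound ν hν k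
  calc _ ≤ (1 / Real.Gamma (ν + 1)) * (1 / (k.factorial : ℝ)) * |q / 4| ^ k := by gcongr
    _ = _ := by ring

lemma hasDerivAt_Gs (ν : ℝ) (hν : 0 ≤ ν) (q : ℝ) :
    HasDerivAt (Gs ν) (-(1 / 4) * Gs (ν + 1) q) q := by
  set a : ℕ → ℝ := fun k => (-1 : ℝ) ^ k / (Real.Gamma (k + 1) * Real.Gamma (k + ν + 1)) with ha
  set R : ℝ := |q / 4| + 1 with hR
  have hRpos : 0 ≤ R := by positivity
  have hu : Summable (fun k : ℕ => (1 / Real.Gamma (ν + 1)) * (k / (k.factorial : ℝ) * R ^ (k - 1) * (1/4))) := by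
    apply Summable.mul_left
    rw [← summable_nat_add_iff 1]
    refine ((Real.summable_pow_div_factorial R).mul_right (1/4)).congr (fun k => ?_)
    rw [Nat.factorial_succ]
    push_cast
    have : (k.factorial : ℝ) ≠ 0 := by positivity
    have : (k : ℝ) + 1 ≠ 0 := by positivity
    field_simp
  have key := hasDerivAt_tsum_of_isPreconnected (g := fun (k : ℕ) (q : ℝ) => a k * (q / 4) ^ k)
    (g' := fun k q => a k * (k * (q / 4) ^ (k - 1) * (1 / 4))) (y₀ := q) (y := q)
    (t := Metric.ball q 1) hu
    Metric.isOpen_ball (convex_ball q 1).isPreconnected ?_ ?_ (by simp) (summable_Gs ν hν q) (by simp)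
  · have h2 : ∑' k : ℕ, a k * (k * (q / 4) ^ (k - 1) * (1 / 4)) = -(1 / 4) * Gs (ν + 1) q := by
      rw [tsum_eq_zero_add' ]
      · simp only [CharP.cast_eq_zero, zero_mul, mul_zero, zero_add]
        unfold Gs
        rw [← tsum_mul_left]
        congr 1
        ext k
        simp only [ha, Nat.add_sub_cancel]
        rw [Real.Gamma_nat_eq_factorial, Real.Gamma_nat_eq_factorial, Nat.factorial_succ]
        have e : ((k + 1 : ℕ) : ℝ) + ν + 1 = k + (ν + 1) + 1 := by push_cast; ring
        rw [e]
        have : Real.Gamma (k + (ν + 1) + 1) ≠ 0 := (Real.Gamma_pos_of_pos (by positivity)).ne'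
        have : (k.factorial : ℝ) ≠ 0 := by positivity
        have : (k : ℝ) + 1 ≠ 0 := by positivity
        push_cast
        field_simp
        ring
      · have := (summable_Gs (ν + 1) (by positivity) q).mul_left (-(1/4))
        refine this.congr (fun k => ?_)
        simp only [ha, Nat.add_sub_cancel]
        rw [Real.Gamma_nat_eq_factorial, Real.Gamma_nat_eq_factorial, Nat.factorial_succ]
        have e : ((k + 1 : ℕ) : ℝ) + ν + 1 = k + (ν + 1) + 1 := by push_cast; ring
        rw [e]
        have : Real.Gamma (k + (ν + 1) + 1) ≠ 0 := (Real.Gamma_pos_of_pos (by positivity)).ne'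
        have : (k.factorial : ℝ) ≠ 0 := by positivity
        have : (k : ℝ) + 1 ≠ 0 := by positivity
        push_cast
        field_simp
        ring
    rw [h2] at key
    exact key
  · intro k x hx
    have := (((hasDerivAt_id x).div_const 4).pow k).const_mul (a k)
    exact this
  · intro k x hx
    rw [Metric.mem_ball, Real.dist_eq] at hx
    have hx' : |x / 4| ≤ R := by
      have : |x| ≤ |x - q| + |q| := by simpa using abs_add_le (x - q) q
      rw [hR, abs_div, abs_div, abs_of_pos (by norm_num : (0:ℝ) < 4)]
      linarith
    rw [Real.norm_eq_abs, abs_mul, abs_mul, abs_mul, abs_pow, Nat.abs_cast,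
      abs_of_pos (by norm_num : (0:ℝ) < 1/4)]
    calc _ ≤ (1 / Real.Gamma (ν + 1)) * (1 / (k.factorial : ℝ)) * (k * R ^ (k - 1) * (1/4)) := by
            gcongr
            exact coeff_bound ν hν k
      _ = _ := by ring

lemma Gs_rec (ν : ℝ) (hν : 0 ≤ ν) (q : ℝ) :
    (ν + 1) * Gs (ν + 1) q - Gs ν q = q / 4 * Gs (ν + 2) q := by
  have s0 := summable_Gs ν hν q
  have s1 := (summable_Gs (ν + 1) (by positivity) q).mul_left (ν + 1)
  have s2 := (summable_Gs (ν + 2) (by positivity) q).mul_left (q / 4)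
  unfold Gs
  rw [← tsum_mul_left, ← tsum_mul_left, ← s1.tsum_sub s0]
  have e0 : ∀ k : ℕ, (ν + 1) * ((-1 : ℝ) ^ (k+1) / (Real.Gamma ((k+1:ℕ) + 1) * Real.Gamma ((k+1:ℕ) + (ν + 1) + 1)) * (q / 4) ^ (k+1))
     - (-1 : ℝ) ^ (k+1) / (Real.Gamma ((k+1:ℕ) + 1) * Real.Gamma ((k+1:ℕ) + ν + 1)) * (q / 4) ^ (k+1) =
     q / 4 * ((-1 : ℝ) ^ k / (Real.Gamma (k + 1) * Real.Gamma (k + (ν + 2) + 1)) * (q / 4) ^ k) := by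
    intro k
    rw [Real.Gamma_nat_eq_factorial, Real.Gamma_nat_eq_factorial, Nat.factorial_succ]
    have e : ((k + 1 : ℕ) : ℝ) + (ν + 1) + 1 = k + (ν + 2) + 1 := by push_cast; ring
    have e' : (k + (ν + 2) + 1 : ℝ) = (k + ν + 2) + 1 := by ring
    have e'' : ((k + 1 : ℕ) : ℝ) + ν + 1 = k + ν + 2 := by push_cast; ring
    rw [e, e'', e', Real.Gamma_add_one (by positivity)]
    have : Real.Gamma (k + ν + 2) ≠ 0 := (Real.Gamma_pos_of_pos (by positivity)).ne'
    have : (k.factorial : ℝ) ≠ 0 := by positivity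
    have : (k : ℝ) + 1 ≠ 0 := by positivity
    have : (k : ℝ) + ν + 2 ≠ 0 := by positivity
    push_cast
    field_simp
    ring
  rw [tsum_eq_zero_add']
  · rw [tsum_congr e0]
    have : Real.Gamma (ν + 1) ≠ 0 := (Real.Gamma_pos_of_pos (by positivity)).ne'
    have h : Real.Gamma (ν + 1 + 1) = (ν + 1) * Real.Gamma (ν + 1) :=
      Real.Gamma_add_one (by positivity)
    have : ν + 1 ≠ 0 := by positivity
    simp only [CharP.cast_eq_zero, pow_zero, zero_add, h, Real.Gamma_one, one_mul, mul_one]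
    field_simp
    ring
  · exact s2.congr (fun k => (e0 k).symm)

lemma Gs_bound (ν : ℝ) (hν : 0 ≤ ν) (q : ℝ) (hq : 0 ≤ q) : |Gs ν q| ≤ |Gs ν 0| := by
  set e : ℝ → ℝ := fun q => Gs ν q ^ 2 + q / 4 * Gs (ν + 1) q ^ 2 with he
  have hd : ∀ x, HasDerivAt e (-(ν + 1/2) / 2 * Gs (ν + 1) x ^ 2) x := by
    intro x
    have h0 := hasDerivAt_Gs ν hν x
    have h1 := hasDerivAt_Gs (ν + 1) (by positivity) x
    have := (h0.pow 2).add (((hasDerivAt_id x).div_const 4).mul (h1.pow 2))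
    refine this.congr_deriv ?_
    have r := Gs_rec ν hν x
    have e2 : ν + 1 + 1 = ν + 2 := by ring
    rw [e2]
    simp only [Pi.pow_apply, id]
    push_cast
    linear_combination (1/2) * Gs (ν+1) x * r
  have hanti : Antitone e := antitone_of_hasDerivAt_nonpos hd (fun x => by
    have := sq_nonneg (Gs (ν + 1) x)
    show _ ≤ (0:ℝ)
    nlinarith [mul_nonneg hν this])
  have := hanti hq
  rw [← sq_le_sq]
  simp only [he] at this
  have h2 := mul_nonneg (by positivity : 0 ≤ q / 4) (sq_nonneg (Gs (ν+1) q))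
  linarith

/-- Euclidean space -/
abbrev Ed (d : ℕ) := EuclideanSpace ℝ (Fin d)

/-- surface measure -/
abbrev sig (d : ℕ) : Measure (Metric.sphere (0 : Ed d) 1) := (volume : Measure (Ed d)).toSphere

lemma polar {F : Type*} [NormedAddCommGroup F] [NormedSpace ℝ F]
    (d : ℕ) (hd : 1 ≤ d) (g : Ed d → F) (hg : Integrable g) :
    ∫ x, g x = ∫ r in Set.Ioi (0 : ℝ), r ^ (d - 1) •
      ∫ ω : Metric.sphere (0 : Ed d) 1, g (r • (ω : Ed d))
        ∂(sig d) := by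
  have hdim : Module.finrank ℝ (Ed d) = d := by simp
  have : Nontrivial (Ed d) := Module.nontrivial_of_finrank_pos (R := ℝ) (by omega)
  have mp := (volume : Measure (Ed d)).measurePreserving_homeomorphUnitSphereProd
  rw [hdim] at mp
  have me := (homeomorphUnitSphereProd (Ed d)).measurableEmbedding
  set G : Metric.sphere (0 : (Ed d)) 1 × Set.Ioi (0:ℝ) → F := fun p => g ((p.2 : ℝ) • (p.1 : (Ed d))) with hG
  have hGc : ∀ x : ({0}ᶜ : Set (Ed d)), G (homeomorphUnitSphereProd (Ed d) x) = g x := by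
    intro x
    have hx : ‖(x : (Ed d))‖ ≠ 0 := norm_ne_zero_iff.2 x.2
    simp only [hG, homeomorphUnitSphereProd_apply_snd_coe, homeomorphUnitSphereProd_apply_fst_coe]
    rw [smul_smul, mul_inv_cancel₀ hx, one_smul]
  have hGi : Integrable G ((sig d).prod (.volumeIoiPow (d - 1))) := by
    rw [← mp.integrable_comp_emb me]
    have : G ∘ (homeomorphUnitSphereProd (Ed d)) = g ∘ Subtype.val := funext hGc
    rw [this, ← integrableOn_iff_comap_subtypeVal (measurableSet_singleton _).compl]
    exact hg.integrableOn
  calc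
    ∫ x, g x = ∫ x : ({(0)}ᶜ : Set (Ed d)), g x ∂(Measure.comap (Subtype.val : ({(0)}ᶜ : Set (Ed d)) → Ed d) volume) := by
      rw [integral_subtype_comap (measurableSet_singleton _).compl g,
        restrict_compl_singleton]
    _ = ∫ p, G p ∂((sig d).prod (.volumeIoiPow (d - 1))) := by
      rw [← mp.integral_comp me]
      exact integral_congr_ae (.of_forall fun x => (hGc x).symm)
    _ = ∫ r, ∫ ω, G (ω, r) ∂(sig d) ∂(.volumeIoiPow (d - 1)) :=
      integral_prod_symm _ hGi
    _ = _ := by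
      simp only [Measure.volumeIoiPow, ENNReal.ofReal]
      rw [integral_withDensity_eq_integral_smul,
        integral_subtype_comap measurableSet_Ioi fun a ↦ Real.toNNReal (a ^ (d - 1)) •
          ∫ ω : Metric.sphere (0 : (Ed d)) 1, g (a • (ω : (Ed d))) ∂sig d,
        setIntegral_congr_fun measurableSet_Ioi fun x hx ↦ ?_]
      · show _ = _ • _
        rw [NNReal.smul_def, Real.coe_toNNReal _ (pow_nonneg (le_of_lt hx) _)]
      · exact (measurable_subtype_coe.pow_const _).real_toNNReal

/-- one-dimensional Gaussian moments -/
lemma gauss_radial (n : ℕ) :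
    ∫ r in Set.Ioi (0 : ℝ), r ^ n * Real.exp (-(1/2) * r ^ 2) =
      2 ^ (((n : ℝ) - 1) / 2) * Real.Gamma (((n : ℝ) + 1) / 2) := by
  have := integral_rpow_mul_exp_neg_mul_rpow (p := 2) (q := n) (b := 1/2) (by norm_num)
    (by have : (0:ℝ) ≤ n := by positivity
        linarith) (by norm_num)
  have h2 : ∫ r in Set.Ioi (0 : ℝ), r ^ n * Real.exp (-(1/2) * r ^ 2) =
     ∫ r in Set.Ioi (0 : ℝ), r ^ (n:ℝ) * Real.exp (-(1/2) * r ^ (2:ℝ)) := by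
    refine integral_congr_ae (.of_forall fun x => ?_)
    simp only []
    rw [Real.rpow_natCast, Real.rpow_two]
  rw [h2, this]
  rw [one_div 2, Real.inv_rpow (by norm_num), ← Real.rpow_neg (by norm_num)]
  congr 1
  rw [show (2:ℝ)⁻¹ = 2 ^ (-1 : ℝ) by rw [Real.rpow_neg_one], ← Real.rpow_add (by norm_num)]
  congr 1
  ring

lemma gauss_odd (n : ℕ) (hn : Odd n) : ∫ u : ℝ, u ^ n * Real.exp (-(1/2) * u ^ 2) = 0 := by
  have h := integral_neg_eq_self (fun u : ℝ => u ^ n * Real.exp (-(1/2) * u ^ 2)) volume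
  simp only [hn.neg_pow, neg_sq] at h
  simp only [neg_mul, integral_neg] at h ⊢
  linarith

lemma gauss_even (k : ℕ) : ∫ u : ℝ, u ^ (2 * k) * Real.exp (-(1/2) * u ^ 2) =
    Real.sqrt (2 * Real.pi) * ((2 * k).factorial / (2 ^ k * k.factorial)) := by
  have h := integral_comp_abs (f := fun u : ℝ => u ^ (2 * k) * Real.exp (-(1/2) * u ^ 2))
  simp only [pow_mul, sq_abs] at h
  simp only [pow_mul]
  rw [h]
  have h2 := gauss_radial (2 * k)
  simp only [pow_mul] at h2
  rw [h2]
  have e : (((2 * k : ℕ) : ℝ) + 1) / 2 = k + 1 / 2 := by push_cast; ring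
  rw [e, Real.Gamma_nat_add_half]
  have e2 : ((((2 * k : ℕ) : ℝ) - 1) / 2) = k + (- 1 / 2) := by push_cast; ring
  rw [e2, Real.rpow_add (by norm_num), Real.rpow_natCast, Real.sqrt_mul (by norm_num)]
  have e3 : (2 : ℝ) ^ (-1 / 2 : ℝ) = Real.sqrt 2 / 2 := by
    rw [neg_div, Real.rpow_neg (by norm_num), ← Real.sqrt_eq_rpow]
    have : Real.sqrt 2 * Real.sqrt 2 = 2 := Real.mul_self_sqrt (by norm_num)
    have h0 : Real.sqrt 2 ≠ 0 := by positivity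
    field_simp
    linarith
  rw [e3]
  have e4 : (((2 * k - 1 : ℕ).doubleFactorial : ℕ) : ℝ) = (2 * k).factorial / (2 ^ k * k.factorial) := by
    rw [eq_div_iff (by positivity)]
    rcases k with _ | k
    · simp
    · have : (2 * (k + 1) - 1).doubleFactorial * (2 ^ (k + 1) * (k + 1).factorial) =
          (2 * (k + 1)).factorial := by
        rw [← Nat.doubleFactorial_two_mul,
          show 2 * (k + 1) = (2 * k + 1) + 1 by ring, Nat.factorial_eq_mul_doubleFactorial]
        simp [mul_comm]
      exact_mod_cast this
  rw [e4]
  field_simp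

lemma gauss_moment_space (d : ℕ) (hd : 1 ≤ d) (n : ℕ) (y : EuclideanSpace ℝ (Fin d)) :
    ∫ x : EuclideanSpace ℝ (Fin d), Real.exp (-(1/2) * ‖x‖ ^ 2) * ⟪y, x⟫ ^ n =
      ‖y‖ ^ n * (∫ u : ℝ, u ^ n * Real.exp (-(1/2) * u ^ 2)) * Real.sqrt (2 * Real.pi) ^ (d - 1) := by
  set i0 : Fin d := ⟨0, hd⟩
  -- an orthonormal basis with `y` along the first vector
  obtain ⟨b, hb⟩ : ∃ b : OrthonormalBasis (Fin d) ℝ (EuclideanSpace ℝ (Fin d)), y = ‖y‖ • b i0 := by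
    by_cases hy : y = 0
    · exact ⟨EuclideanSpace.basisFun _ _, by simp [hy]⟩
    · have hy' : ‖y‖ ≠ 0 := norm_ne_zero_iff.2 hy
      obtain ⟨b, hb⟩ := Orthonormal.exists_orthonormalBasis_extension_of_card_eq (𝕜 := ℝ)
        (E := EuclideanSpace ℝ (Fin d)) (ι := Fin d) (by simp) (v := fun _ => ‖y‖⁻¹ • y) (s := {i0}) (by
          constructor
          · intro i
            simp [norm_smul, hy']
          · intro i j hij
            exact absurd (Subsingleton.elim i j) hij)
      refine ⟨b, ?_⟩
      rw [hb i0 rfl, smul_smul, mul_inv_cancel₀ hy', one_smul]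
  let e := b.repr.symm
  rw [← e.measurePreserving.integral_comp e.toHomeomorph.measurableEmbedding]
  have hin : ∀ x, ⟪y, e x⟫ = ‖y‖ * x i0 := by
    intro x
    rw [hb, inner_smul_left, ← b.repr_apply_apply]
    simp [e, norm_smul]
  simp only [hin, LinearIsometryEquiv.norm_map]
  rw [← (PiLp.volume_preserving_toLp (Fin d)).integral_comp
    (MeasurableEquiv.toLp 2 _).measurableEmbedding]
  have hprod : ∀ x : Fin d → ℝ, Real.exp (-(1/2) * ‖WithLp.toLp 2 x‖ ^ 2) * (‖y‖ * x i0) ^ n =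
      ‖y‖ ^ n * ∏ i, ((if i = i0 then (x i) ^ n else 1) * Real.exp (-(1/2) * (x i) ^ 2)) := by
    intro x
    rw [Finset.prod_mul_distrib, ← Real.exp_sum, ← Finset.mul_sum, EuclideanSpace.norm_sq_eq,
      Finset.prod_ite_eq' ]
    simp only [Real.norm_eq_abs, sq_abs, Finset.mem_univ, if_true]
    ring
  have : (∫ x : Fin d → ℝ, Real.exp (-(1/2) * ‖WithLp.toLp 2 x‖ ^ 2) * (‖y‖ * x i0) ^ n) = 
     ‖y‖ ^ n * ∏ i : Fin d, ∫ u : ℝ, ((if i = i0 then u ^ n else 1) * Real.exp (-(1/2) * u ^ 2)) := by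
    simp_rw [hprod]
    rw [integral_const_mul, integral_fintype_prod_volume_eq_prod (fun (i : Fin d) (u : ℝ) => ((if i = i0 then u ^ n else 1) * Real.exp (-(1/2) * u ^ 2)))]
  refine this.trans ?_
  rw [mul_assoc]
  congr 1
  rw [← Finset.mul_prod_erase _ _ (Finset.mem_univ i0)]
  simp only [if_true]
  congr 1
  have h1 : ∀ i ∈ Finset.univ.erase i0, ∫ u : ℝ, ((if i = i0 then u ^ n else 1) * Real.exp (-(1/2) * u ^ 2))
     = Real.sqrt (2 * Real.pi) := by
    intro i hi
    simp only [(Finset.mem_erase.1 hi).1, if_false, one_mul]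
    rw [integral_gaussian]
    congr 1
    ring
  rw [Finset.prod_congr rfl h1, Finset.prod_const]
  simp

lemma pow_gauss_integrable (n : ℕ) :
    IntegrableOn (fun r : ℝ => r ^ n * Real.exp (-(1/2) * r ^ 2)) (Set.Ioi 0) := by
  have := (integrable_rpow_mul_exp_neg_mul_sq (b := 1/2) (by norm_num) (s := n) (by
    have : (0:ℝ) ≤ n := by positivity
    linarith)).integrableOn (s := Set.Ioi 0)
  simpa only [Real.rpow_natCast] using this

lemma sphere_norm {d : ℕ} (ω : Metric.sphere (0 : Ed d) 1) : ‖(ω : Ed d)‖ = 1 := by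
  simp

lemma inner_sphere_le {d : ℕ} (y : Ed d) (ω : Metric.sphere (0 : Ed d) 1) :
    |⟪y, (ω : Ed d)⟫| ≤ ‖y‖ := by
  have := abs_real_inner_le_norm y (ω : Ed d)
  rwa [sphere_norm, mul_one] at this

/-- radial domination gives integrability -/
lemma integrable_radial {d : ℕ} (hd : 1 ≤ d) {F : Type*} [NormedAddCommGroup F] [NormedSpace ℝ F]
    (g : Ed d → F) (hg : Continuous g) (b : ℝ → ℝ) (hb : ∀ x, ‖g x‖ ≤ b ‖x‖)
    (hbi : IntegrableOn (fun r : ℝ => r ^ (d - 1) * b r) (Set.Ioi 0)) : Integrable g := by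
  have hdim : Module.finrank ℝ (Ed d) = d := by simp
  have : Nontrivial (Ed d) := Module.nontrivial_of_finrank_pos (R := ℝ) (by omega)
  have h : Integrable (fun x : Ed d => b ‖x‖) := by
    rw [integrable_fun_norm_addHaar volume (f := b), hdim]
    exact hbi
  exact h.mono' hg.aestronglyMeasurable (.of_forall hb)

lemma sphere_moment (d : ℕ) (hd : 1 ≤ d) (n : ℕ) (y : Ed d) :
    (∫ ω, ⟪y, (ω : Ed d)⟫ ^ n ∂(sig d)) *
      (2 ^ (((n + d - 1 : ℕ) - 1 : ℝ) / 2) * Real.Gamma (((n + d - 1 : ℕ) + 1 : ℝ) / 2)) =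
    ‖y‖ ^ n * (∫ u : ℝ, u ^ n * Real.exp (-(1/2) * u ^ 2)) * Real.sqrt (2 * Real.pi) ^ (d - 1) := by
  rw [← gauss_moment_space d hd, ← gauss_radial, polar d hd]
  · rw [← integral_const_mul]
    refine setIntegral_congr_fun measurableSet_Ioi (fun r hr => ?_)
    have hr' : (0:ℝ) < r := hr
    simp only [inner_smul_right, norm_smul, sphere_norm, mul_one, mul_pow, Real.norm_eq_abs, sq_abs,
      smul_eq_mul]
    rw [integral_const_mul, integral_const_mul, show n + d - 1 = (d - 1) + n by omega, pow_add]
    ring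
  · refine integrable_radial hd _ (by fun_prop) (fun r => ‖y‖ ^ n * (r ^ n * Real.exp (-(1/2) * r ^ 2))) ?_ ?_
    · intro x
      rw [norm_mul, Real.norm_eq_abs, Real.abs_exp, norm_pow, Real.norm_eq_abs]
      have := pow_le_pow_left₀ (abs_nonneg _) (abs_real_inner_le_norm y x) n
      rw [mul_pow] at this
      calc _ ≤ Real.exp (-(1/2) * ‖x‖ ^ 2) * (‖y‖ ^ n * ‖x‖ ^ n) := by gcongr
        _ = _ := by ring
    · have := (pow_gauss_integrable ((d - 1) + n)).const_mul (‖y‖ ^ n)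
      refine this.congr (.of_forall fun r => ?_)
      simp only [pow_add]
      ring

lemma sphere_moment_odd (d : ℕ) (hd : 1 ≤ d) (n : ℕ) (hn : Odd n) (y : Ed d) :
    ∫ ω, ⟪y, (ω : Ed d)⟫ ^ n ∂(sig d) = 0 := by
  have h := sphere_moment d hd n y
  rw [gauss_odd n hn, mul_zero, zero_mul] at h
  refine (mul_eq_zero.1 h).resolve_right ?_
  have : 0 < Real.Gamma (((n + d - 1 : ℕ) + 1 : ℝ) / 2) := Real.Gamma_pos_of_pos (by positivity)
  positivity

lemma sphere_moment_even (d : ℕ) (hd : 2 ≤ d) (α : ℝ) (hα : α = ((d : ℝ) - 2) / 2) (k : ℕ) (y : Ed d) :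
    ∫ ω, ⟪y, (ω : Ed d)⟫ ^ (2 * k) ∂(sig d) = (2 * Real.pi) ^ ((d : ℝ) / 2) * 2 ^ (-α) *
      ((2 * k).factorial / (k.factorial * Real.Gamma (k + α + 1)) * (‖y‖ ^ 2 / 4) ^ k) := by
  have h := sphere_moment d (by omega) (2 * k) y
  rw [gauss_even] at h
  have hα0 : 0 ≤ α := by
    rw [hα]
    have : (2:ℝ) ≤ d := by exact_mod_cast hd
    linarith
  have e0 : ((2 * k + d - 1 : ℕ) : ℝ) = 2 * k + d - 1 := by
    rw [Nat.cast_sub (by omega)]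
    push_cast
    ring
  have e1 : (((2 * k + d - 1 : ℕ) : ℝ) - 1) / 2 = k + α := by rw [e0, hα]; ring
  have e2 : (((2 * k + d - 1 : ℕ) : ℝ) + 1) / 2 = k + α + 1 := by rw [e0, hα]; ring
  rw [e1, e2, Real.rpow_add (by norm_num), Real.rpow_natCast] at h
  have e3 : (2 * Real.pi) ^ ((d : ℝ) / 2) = Real.sqrt (2 * Real.pi) * Real.sqrt (2 * Real.pi) ^ (d - 1) := by
    rw [← pow_succ', Nat.sub_add_cancel (by omega), Real.sqrt_eq_rpow, ← Real.rpow_natCast,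
      ← Real.rpow_mul (by positivity)]
    congr 1
    ring
  have hG : 0 < Real.Gamma (k + α + 1) := Real.Gamma_pos_of_pos (by positivity)
  have h2 : (0:ℝ) < 2 ^ α := by positivity
  rw [e3, Real.rpow_neg (by norm_num)]
  have h4 : ((‖y‖ ^ 2 / 4) ^ k) = ‖y‖ ^ (2 * k) / (2 ^ k * 2 ^ k) := by
    rw [div_pow, ← pow_mul, ← mul_pow]
    norm_num
  rw [h4]
  rw [← eq_div_iff (by positivity)] at h
  rw [h]
  field_simp

lemma sphere_base (d : ℕ) (hd : 2 ≤ d) (α : ℝ) (hα : α = ((d : ℝ) - 2) / 2) (y : Ed d) :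
    ∫ ω, Complex.exp (Complex.I * (⟪y, (ω : Ed d)⟫ : ℝ)) ∂(sig d) =
      (((2 * Real.pi) ^ ((d : ℝ) / 2) * (2 ^ (-α) * Gs α (‖y‖ ^ 2)) : ℝ) : ℂ) := by
  have hα0 : 0 ≤ α := by
    rw [hα]
    have : (2:ℝ) ≤ d := by exact_mod_cast hd
    linarith
  set F : ℕ → Metric.sphere (0 : Ed d) 1 → ℂ := fun n ω =>
    Complex.I ^ n / n.factorial * ((⟪y, (ω : Ed d)⟫ ^ n : ℝ) : ℂ) with hF
  have hFc : ∀ n, Continuous (F n) := by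
    intro n
    simp only [hF]
    fun_prop
  have hFb : ∀ n ω, ‖F n ω‖ ≤ ‖y‖ ^ n / n.factorial := by
    intro n ω
    simp only [hF]
    rw [norm_mul, norm_div, norm_pow, Complex.norm_I, one_pow, Complex.norm_natCast, Complex.norm_real,
      norm_pow, Real.norm_eq_abs, one_div, div_eq_inv_mul]
    gcongr
    exact inner_sphere_le y ω
  have hFi : ∀ n, Integrable (F n) (sig d) := fun n =>
    Integrable.of_bound (hFc n).aestronglyMeasurable _ (.of_forall (hFb n))
  have hsum : Summable fun n => ∫ ω, ‖F n ω‖ ∂(sig d) := by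
    refine Summable.of_nonneg_of_le (fun n => integral_nonneg fun _ => norm_nonneg _) (fun n => ?_)
      ((Real.summable_pow_div_factorial ‖y‖).mul_left ((sig d).real Set.univ))
    calc _ ≤ ∫ ω, ‖y‖ ^ n / n.factorial ∂(sig d) :=
          integral_mono (hFi n).norm (integrable_const _) (hFb n)
      _ = _ := by rw [integral_const, smul_eq_mul]
  have key := hasSum_integral_of_summable_integral_norm hFi hsum
  have hexp : ∀ ω, ∑' n, F n ω = Complex.exp (Complex.I * (⟪y, (ω : Ed d)⟫ : ℝ)) := by
    intro ω
    rw [Complex.exp_eq_exp_ℂ, NormedSpace.exp_eq_tsum_div]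
    refine tsum_congr fun n => ?_
    show Complex.I ^ n / n.factorial * ((⟪y, (ω : Ed d)⟫ ^ n : ℝ) : ℂ) = _
    rw [mul_pow Complex.I, Complex.ofReal_pow]
    ring
  simp only [hexp] at key
  have hval : ∀ n, ∫ ω, F n ω ∂(sig d) = Complex.I ^ n / n.factorial *
      ((∫ ω, ⟪y, (ω : Ed d)⟫ ^ n ∂(sig d) : ℝ) : ℂ) := by
    intro n
    simp only [hF]
    exact (integral_const_mul _ _).trans (congrArg _ integral_complex_ofReal)
  refine key.tsum_eq.symm.trans ?_
  have s1 : Summable fun k => ∫ ω, F (2 * k) ω ∂(sig d) :=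
    key.summable.comp_injective (fun a b h => by simpa using h)
  have s2 : Summable fun k => ∫ ω, F (2 * k + 1) ω ∂(sig d) :=
    key.summable.comp_injective (fun a b h => by simpa using h)
  refine (tsum_even_add_odd (f := fun n => ∫ ω, F n ω ∂(sig d)) s1 s2).symm.trans ?_
  have z : ∀ k, ∫ ω, F (2 * k + 1) ω ∂(sig d) = 0 := by
    intro k
    rw [hval, sphere_moment_odd d (by omega) _ ⟨k, rfl⟩]
    simp
  simp only [z, tsum_zero, add_zero]
  unfold Gs
  rw [← mul_assoc]
  rw [← tsum_mul_left]
  rw [Complex.ofReal_tsum]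
  refine tsum_congr fun k => ?_
  rw [hval]
  rw [sphere_moment_even d hd α hα]
  rw [pow_mul Complex.I, Complex.I_sq]
  rw [Real.Gamma_nat_eq_factorial k]
  have : ((2 * k).factorial : ℂ) ≠ 0 := by exact_mod_cast (Nat.factorial_pos _).ne'
  push_cast
  field_simp

section poly
variable {d : ℕ}

lemma pderiv_comm' (i j : Fin d) (P : MvPolynomial (Fin d) ℝ) :
    pderiv i (pderiv j P) = pderiv j (pderiv i P) := by
  have h : ⁅(pderiv i : Derivation ℝ (MvPolynomial (Fin d) ℝ) (MvPolynomial (Fin d) ℝ)),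
      (pderiv j : Derivation ℝ (MvPolynomial (Fin d) ℝ) (MvPolynomial (Fin d) ℝ))⁆ = 0 := by
    apply MvPolynomial.derivation_ext
    intro k
    rw [Derivation.commutator_apply, pderiv_X, pderiv_X]
    by_cases h1 : j = k <;> by_cases h2 : i = k <;>
      simp [Pi.single_apply, h1, h2, eq_comm]
  have := congrArg (fun D => D P) h
  simpa [Derivation.commutator_apply, sub_eq_zero] using this

/-- the Laplacian as a linear map -/
def lapL : MvPolynomial (Fin d) ℝ →ₗ[ℝ] MvPolynomial (Fin d) ℝ :=
  ∑ i, (pderiv i).toLinearMap ∘ₗ (pderiv i).toLinearMap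

lemma lapL_apply (P : MvPolynomial (Fin d) ℝ) : lapL P = lap P := by
  simp [lapL, lap]

lemma lap_iter (k : ℕ) (P : MvPolynomial (Fin d) ℝ) : lap^[k] P = (lapL ^ k) P := by
  have : (lap : MvPolynomial (Fin d) ℝ → _) = lapL := funext fun P => (lapL_apply P).symm
  rw [this, Module.End.pow_apply]

lemma lap_pderiv (j : Fin d) (P : MvPolynomial (Fin d) ℝ) :
    lap (pderiv j P) = pderiv j (lap P) := by
  simp only [lap, map_sum]
  refine Finset.sum_congr rfl fun i _ => ?_
  rw [pderiv_comm' i j, pderiv_comm' i j]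

lemma lap_X_mul (j : Fin d) (P : MvPolynomial (Fin d) ℝ) :
    lap (X j * P) = X j * lap P + 2 * pderiv j P := by
  simp only [lap]
  have : ∀ i, pderiv i (pderiv i (X j * P)) =
      X j * pderiv i (pderiv i P) + (if i = j then 2 * pderiv j P else 0) := by
    intro i
    rw [pderiv_mul, map_add, pderiv_mul, pderiv_mul, pderiv_X]
    by_cases h : i = j
    · subst h
      simp
      ring
    · simp [Ne.symm h, h]
  simp only [this, Finset.sum_add_distrib, Finset.mul_sum]
  simp

lemma lap_add (P Q : MvPolynomial (Fin d) ℝ) : lap (P + Q) = lap P + lap Q := by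
  simp only [← lapL_apply, map_add]

lemma two_eq_C : (2 : MvPolynomial (Fin d) ℝ) = C 2 := (map_ofNat C 2).symm

lemma lap_iter_X_mul (j : Fin d) (k : ℕ) (P : MvPolynomial (Fin d) ℝ) :
    lap^[k + 1] (X j * P) = X j * lap^[k + 1] P + C (2 * (k + 1 : ℝ)) * pderiv j (lap^[k] P) := by
  induction k with
  | zero =>
    simp only [zero_add, Function.iterate_one, Function.iterate_zero, id, lap_X_mul]
    simp [two_eq_C]
  | succ k ih =>
    rw [Function.iterate_succ_apply', ih, lap_add, lap_X_mul, ← Function.iterate_succ_apply' lap]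
    rw [← smul_eq_C_mul, ← lapL_apply (_ • _), map_smul, lapL_apply, lap_pderiv,
      ← Function.iterate_succ_apply' lap, smul_eq_C_mul, add_assoc]
    congr 1
    have : (C (2 * ((k + 1 : ℕ) + 1 : ℝ)) : MvPolynomial (Fin d) ℝ) = 2 + C (2 * (k + 1 : ℝ)) := by
      rw [two_eq_C, ← C_add]
      congr 1
      push_cast
      ring
    rw [this]
    ring

lemma lap_homog {l : ℕ} {P : MvPolynomial (Fin d) ℝ} (hP : P.IsHomogeneous l) :
    (lap P).IsHomogeneous (l - 2) :=
  IsHomogeneous.sum _ _ _ fun i _ => by simpa [Nat.sub_sub] using (hP.pderiv (i := i)).pderiv (i := i)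

lemma lap_iter_homog {l : ℕ} {P : MvPolynomial (Fin d) ℝ} (hP : P.IsHomogeneous l) (k : ℕ) :
    (lap^[k] P).IsHomogeneous (l - 2 * k) := by
  induction k with
  | zero => simpa
  | succ k ih =>
    rw [Function.iterate_succ_apply']
    have := lap_homog ih
    rwa [show l - 2 * k - 2 = l - 2 * (k + 1) by omega] at this

lemma pderiv_homog_zero {P : MvPolynomial (Fin d) ℝ} (hP : P.IsHomogeneous 0) (i : Fin d) :
    pderiv i P = 0 := by
  rw [← totalDegree_zero_iff_isHomogeneous, totalDegree_eq_zero_iff_eq_C] at hP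
  rw [hP, pderiv_C]

lemma lap_iter_zero {l : ℕ} {P : MvPolynomial (Fin d) ℝ} (hP : P.IsHomogeneous l) (k : ℕ)
    (hk : l < 2 * k) : lap^[k] P = 0 := by
  induction k generalizing l P with
  | zero => omega
  | succ k ih =>
    rw [Function.iterate_succ_apply]
    by_cases hl : 2 ≤ l
    · exact ih (lap_homog hP) (by omega)
    · have : lap P = 0 := by
        refine Finset.sum_eq_zero fun i _ => pderiv_homog_zero ?_ i
        have := hP.pderiv (i := i)
        rwa [show l - 1 = 0 by omega] at this
      rw [this, lap_iter, map_zero]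

lemma eval_homog {l : ℕ} {P : MvPolynomial (Fin d) ℝ} (hP : P.IsHomogeneous l) (r : ℝ)
    (y : Ed d) : eval (fun i => (r • y) i) P = r ^ l * eval (fun i => y i) P := by
  rw [eval_eq, eval_eq, Finset.mul_sum]
  refine Finset.sum_congr rfl fun m hm => ?_
  have hdeg := hP (mem_support_iff.1 hm)
  simp only [PiLp.smul_apply, smul_eq_mul, mul_pow, Finset.prod_mul_distrib]
  rw [Finset.prod_pow_eq_pow_sum]
  have : ∑ i ∈ m.support, m i = l := by
    rw [← hdeg]
    exact congrArg (fun g => g m) (Finsupp.degree_eq_weight_one (σ := Fin d) (R := ℕ))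
  rw [this]
  ring

lemma eval_cont (P : MvPolynomial (Fin d) ℝ) : Continuous fun x : Ed d => eval (fun i => x i) P :=
  (MvPolynomial.continuous_eval P).comp (by fun_prop)

lemma eval_line (P : MvPolynomial (Fin d) ℝ) (y : Ed d) (j : Fin d) :
    HasDerivAt (fun s : ℝ => eval (fun i => (y + s • EuclideanSpace.single j (1:ℝ)) i) P)
      (eval (fun i => y i) (pderiv j P)) 0 := by
  induction P using MvPolynomial.induction_on with
  | C a => simpa using hasDerivAt_const (0:ℝ) a
  | add p q hp hq =>
    simp only [map_add]
    exact hp.add hq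
  | mul_X p i hp =>
    have hX : HasDerivAt (fun s : ℝ => (y + s • EuclideanSpace.single j (1:ℝ)) i)
       (if i = j then 1 else 0) 0 := by
      have := ((hasDerivAt_id (0:ℝ)).mul_const (if i = j then (1:ℝ) else 0)).const_add (y i)
      simpa [Pi.single_apply] using this
    have := hp.mul hX
    simp only [map_mul, eval_X]
    refine this.congr_deriv ?_
    by_cases h : i = j
    · subst h
      simp
      ring
    · simp [pderiv_X, Pi.single_apply, h]
      ring

end poly

section sphereId
variable {d : ℕ}

/-- normalised radial Bessel kernel -/
def gg (ν : ℝ) (y : Ed d) : ℝ := 2 ^ (-ν) * Gs ν (‖y‖ ^ 2)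

lemma norm_line (y : Ed d) (j : Fin d) (s : ℝ) :
    ‖y + s • EuclideanSpace.single j (1:ℝ)‖ ^ 2 = ‖y‖ ^ 2 + 2 * s * y j + s ^ 2 := by
  rw [@norm_add_sq_real, inner_smul_right, norm_smul]
  simp [EuclideanSpace.inner_single_right, mul_pow]
  ring

lemma gg_line (ν : ℝ) (hν : 0 ≤ ν) (y : Ed d) (j : Fin d) :
    HasDerivAt (fun s : ℝ => gg ν (y + s • EuclideanSpace.single j (1:ℝ)))
      (-(y j) * gg (ν + 1) y) 0 := by
  unfold gg
  simp only [norm_line]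
  have h1 : HasDerivAt (fun s : ℝ => ‖y‖ ^ 2 + 2 * s * y j + s ^ 2) (2 * y j) 0 := by
    have := ((((hasDerivAt_id (0:ℝ)).const_mul 2).mul_const (y j)).const_add (‖y‖ ^ 2)).add
      ((hasDerivAt_id (0:ℝ)).pow 2)
    refine this.congr_deriv ?_
    simp
  have h2 : HasDerivAt (Gs ν) (-(1/4) * Gs (ν + 1) (‖y‖ ^ 2)) (‖y‖ ^ 2 + 2 * 0 * y j + 0 ^ 2) := by
    have h := hasDerivAt_Gs ν hν (‖y‖ ^ 2)
    have e : ‖y‖ ^ 2 + 2 * 0 * y j + 0 ^ 2 = ‖y‖ ^ 2 := by ring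
    rw [e]; exact h
  have h3 := (HasDerivAt.comp (0:ℝ) h2 h1).const_mul ((2:ℝ) ^ (-ν))
  refine h3.congr_deriv ?_
  have : (2:ℝ) ^ (-(ν + 1)) = 2 ^ (-ν) / 2 := by
    rw [neg_add, ← sub_eq_add_neg, Real.rpow_sub_one (by norm_num)]
  rw [this]; ring

/-- the right-hand sum -/
def RS (α : ℝ) (l : ℕ) (P : MvPolynomial (Fin d) ℝ) (y : Ed d) : ℝ :=
  ∑ k ∈ Finset.range (l + 1), (-1 : ℝ) ^ k / (2 ^ k * (Nat.factorial k)) * gg (α + l - k) y *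
    eval (fun i => y i) (lap^[k] P)

/-- the spherical integral -/
def SI (P : MvPolynomial (Fin d) ℝ) (y : Ed d) : ℂ :=
  ∫ ω : Metric.sphere (0 : Ed d) 1, ((eval (fun i => (ω : Ed d) i) P : ℝ) : ℂ) *
    Complex.exp (Complex.I * (⟪y, (ω : Ed d)⟫ : ℝ)) ∂(sig d)

lemma RS_line (α : ℝ) (hα : 0 ≤ α) (l : ℕ) (Q : MvPolynomial (Fin d) ℝ) (hQ : Q.IsHomogeneous l)
    (y : Ed d) (j : Fin d) :
    HasDerivAt (fun s : ℝ => RS α l Q (y + s • EuclideanSpace.single j (1:ℝ)))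
      (-RS α (l + 1) (X j * Q) y) 0 := by
  unfold RS
  have h := HasDerivAt.fun_sum (u := Finset.range (l + 1)) (x := (0:ℝ))
    (A := fun k (s : ℝ) => (-1 : ℝ) ^ k / (2 ^ k * (Nat.factorial k)) *
      gg (α + l - k) (y + s • EuclideanSpace.single j (1:ℝ)) *
      eval (fun i => (y + s • EuclideanSpace.single j (1:ℝ)) i) (lap^[k] Q))
    (A' := fun k => (-1 : ℝ) ^ k / (2 ^ k * (Nat.factorial k)) *
      (-(y j) * gg (α + l - k + 1) y) * eval (fun i => y i) (lap^[k] Q) +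
      (-1 : ℝ) ^ k / (2 ^ k * (Nat.factorial k)) * gg (α + l - k) y *
        eval (fun i => y i) (pderiv j (lap^[k] Q))) ?_
  · refine h.congr_deriv ?_
    rw [Finset.sum_range_succ' _ (l + 1)]
    have hz : ∑ k ∈ Finset.range (l + 1), (-1 : ℝ) ^ k / (2 ^ k * (Nat.factorial k)) *
        (-(y j) * gg (α + l - k + 1) y) * eval (fun i => y i) (lap^[k] Q)
        = ∑ k ∈ Finset.range (l + 1), (-1 : ℝ) ^ (k+1) / (2 ^ (k+1) * (Nat.factorial (k+1))) *
        (-(y j) * gg (α + l - k) y) * eval (fun i => y i) (lap^[k+1] Q)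
         + (-(y j) * gg (α + l + 1) y) * eval (fun i => y i) Q := by
      have h0 : lap^[l+1] Q = 0 := lap_iter_zero hQ (l+1) (by omega)
      have e1 := Finset.sum_range_succ (fun k : ℕ => (-1 : ℝ) ^ k / (2 ^ k * (Nat.factorial k)) *
        (-(y j) * gg (α + l - k + 1) y) * eval (fun i => y i) (lap^[k] Q)) (l+1)
      have e2 := Finset.sum_range_succ' (fun k : ℕ => (-1 : ℝ) ^ k / (2 ^ k * (Nat.factorial k)) *
        (-(y j) * gg (α + l - k + 1) y) * eval (fun i => y i) (lap^[k] Q)) (l+1)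
      rw [h0, map_zero, mul_zero, add_zero] at e1
      rw [← e1, e2]
      congr 1
      · refine Finset.sum_congr rfl fun k _ => ?_
        have : α + l - ((k + 1 : ℕ) : ℝ) + 1 = α + l - k := by push_cast; ring
        rw [this]
      · simp
    rw [Finset.sum_add_distrib, hz, neg_add, ← Finset.sum_neg_distrib]
    rw [add_right_comm, ← Finset.sum_add_distrib]
    congr 1
    · refine Finset.sum_congr rfl fun k _ => ?_
      have : α + ((l + 1 : ℕ) : ℝ) - ((k + 1 : ℕ) : ℝ) = α + l - k := by push_cast; ring
      rw [this, lap_iter_X_mul, map_add, map_mul, map_mul, eval_X, eval_C, Nat.factorial_succ]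
      push_cast
      have : (Nat.factorial k : ℝ) ≠ 0 := by positivity
      have : (k + 1 : ℝ) ≠ 0 := by positivity
      field_simp
      ring
    · have : α + ((l + 1 : ℕ) : ℝ) - ((0 : ℕ) : ℝ) = α + l + 1 := by push_cast; ring
      rw [this]
      simp
      ring
  · intro k hk
    have hk' : (k : ℝ) ≤ l := by
      exact_mod_cast Nat.lt_succ_iff.mp (Finset.mem_range.mp hk)
    have h1 := ((gg_line (α + l - k) (by linarith) y j).const_mul
      ((-1 : ℝ) ^ k / (2 ^ k * (Nat.factorial k)))).mul (eval_line (lap^[k] Q) y j)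
    refine h1.congr_deriv ?_
    simp

lemma sphere_integrable {g : Metric.sphere (0 : Ed d) 1 → ℂ} (hg : Continuous g) :
    Integrable g (sig d) := by
  rw [← integrableOn_univ]
  exact hg.continuousOn.integrableOn_compact isCompact_univ

lemma SI_integrand_cont (P : MvPolynomial (Fin d) ℝ) (y : Ed d) :
    Continuous fun ω : Metric.sphere (0 : Ed d) 1 => ((eval (fun i => (ω : Ed d) i) P : ℝ) : ℂ) *
      Complex.exp (Complex.I * (⟪y, (ω : Ed d)⟫ : ℝ)) := by
  have h := (eval_cont P).comp (continuous_subtype_val : Continuous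
    (fun ω : Metric.sphere (0 : Ed d) 1 => (ω : Ed d)))
  have h1 : Continuous fun ω : Metric.sphere (0 : Ed d) 1 => ((eval (fun i => (ω : Ed d) i) P : ℝ) : ℂ) :=
    Complex.continuous_ofReal.comp h
  have h2 : Continuous fun ω : Metric.sphere (0 : Ed d) 1 =>
      Complex.exp (Complex.I * (⟪y, (ω : Ed d)⟫ : ℝ)) := by fun_prop
  exact h1.mul h2

lemma SI_line (Q : MvPolynomial (Fin d) ℝ) (y : Ed d) (j : Fin d) :
    HasDerivAt (fun s : ℝ => SI Q (y + s • EuclideanSpace.single j (1:ℝ)))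
      (Complex.I * SI (X j * Q) y) 0 := by
  unfold SI
  have hin : ∀ (s : ℝ) (ω : Metric.sphere (0 : Ed d) 1),
      (⟪y + s • EuclideanSpace.single j (1:ℝ), (ω : Ed d)⟫ : ℝ) = ⟪y, (ω : Ed d)⟫ + s * (ω : Ed d) j := by
    intro s ω
    rw [inner_add_left, inner_smul_left]
    simp [EuclideanSpace.inner_single_left]
  have key := hasDerivAt_integral_of_dominated_loc_of_deriv_le (μ := sig d) (x₀ := (0:ℝ))
    (s := Set.univ)
    (F := fun (s : ℝ) (ω : Metric.sphere (0 : Ed d) 1) =>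
      ((eval (fun i => (ω : Ed d) i) Q : ℝ) : ℂ) *
      Complex.exp (Complex.I * (⟪y + s • EuclideanSpace.single j (1:ℝ), (ω : Ed d)⟫ : ℝ)))
    (F' := fun (s : ℝ) (ω : Metric.sphere (0 : Ed d) 1) =>
      Complex.I * (((eval (fun i => (ω : Ed d) i) (X j * Q) : ℝ) : ℂ) *
      Complex.exp (Complex.I * (⟪y + s • EuclideanSpace.single j (1:ℝ), (ω : Ed d)⟫ : ℝ))))
    (bound := fun ω => ‖(eval (fun i => (ω : Ed d) i) (X j * Q) : ℝ)‖)
    Filter.univ_mem ?_ ?_ ?_ ?_ ?_ ?_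
  · have := key.2
    refine this.congr_deriv ?_
    rw [integral_const_mul]
    simp
  · exact Filter.Eventually.of_forall fun s => (SI_integrand_cont Q _).aestronglyMeasurable
  · exact sphere_integrable (SI_integrand_cont Q _)
  · exact (continuous_const.mul (SI_integrand_cont (X j * Q) _)).aestronglyMeasurable
  · refine Filter.Eventually.of_forall fun ω s _ => ?_
    rw [norm_mul, norm_mul, Complex.norm_I, one_mul, mul_comm Complex.I, Complex.norm_exp_ofReal_mul_I,
      mul_one, Complex.norm_real]
  · have h := (eval_cont (X j * Q)).comp (continuous_subtype_val : Continuous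
      (fun ω : Metric.sphere (0 : Ed d) 1 => (ω : Ed d)))
    rw [← integrableOn_univ]
    exact h.norm.continuousOn.integrableOn_compact isCompact_univ
  · refine Filter.Eventually.of_forall fun ω s _ => ?_
    simp only [hin]
    have h1 : HasDerivAt (fun s : ℝ => Complex.I * (((⟪y, (ω : Ed d)⟫ + s * (ω : Ed d) j : ℝ)) : ℂ))
        (Complex.I * (((ω : Ed d) j : ℝ) : ℂ)) s := by
      have h0 : HasDerivAt (fun s : ℝ => (⟪y, (ω : Ed d)⟫ + s * (ω : Ed d) j : ℝ)) ((ω : Ed d) j) s := by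
        have := ((hasDerivAt_id s).mul_const ((ω : Ed d) j)).const_add (⟪y, (ω : Ed d)⟫ : ℝ)
        refine this.congr_deriv ?_
        simp
      exact h0.ofReal_comp.const_mul Complex.I
    have h2 := h1.cexp.const_mul ((eval (fun i => (ω : Ed d) i) Q : ℝ) : ℂ)
    refine h2.congr_deriv ?_
    rw [map_mul, eval_X]
    push_cast
    ring

lemma SI_sum (ι : Type) (s : Finset ι) (Q : ι → MvPolynomial (Fin d) ℝ) (y : Ed d) :
    SI (∑ i ∈ s, Q i) y = ∑ i ∈ s, SI (Q i) y := by
  unfold SI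
  rw [← integral_finsetSum s (fun i _ => sphere_integrable (SI_integrand_cont (Q i) y))]
  congr 1
  funext ω
  rw [map_sum, Complex.ofReal_sum, Finset.sum_mul]

lemma SI_smul (c : ℝ) (Q : MvPolynomial (Fin d) ℝ) (y : Ed d) :
    SI (c • Q) y = c * SI Q y := by
  unfold SI
  rw [← integral_const_mul]
  congr 1
  funext ω
  rw [smul_eval]
  push_cast
  ring

lemma RS_sum (α : ℝ) (l : ℕ) (ι : Type) (s : Finset ι) (Q : ι → MvPolynomial (Fin d) ℝ) (y : Ed d) :
    RS α l (∑ i ∈ s, Q i) y = ∑ i ∈ s, RS α l (Q i) y := by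
  unfold RS
  rw [Finset.sum_comm]
  refine Finset.sum_congr rfl fun k _ => ?_
  simp only [lap_iter, map_sum, Finset.mul_sum]

lemma RS_smul (α : ℝ) (l : ℕ) (c : ℝ) (Q : MvPolynomial (Fin d) ℝ) (y : Ed d) :
    RS α l (c • Q) y = c * RS α l Q y := by
  unfold RS
  rw [Finset.mul_sum]
  refine Finset.sum_congr rfl fun k _ => ?_
  simp only [lap_iter, map_smul, smul_eval]
  ring

theorem sphere_identity (hd : 2 ≤ d) (α : ℝ) (hα : α = ((d:ℝ) - 2) / 2) (l : ℕ) :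
    ∀ (P : MvPolynomial (Fin d) ℝ) (_ : P.IsHomogeneous l) (y : Ed d),
    SI P y = (((2 * Real.pi) ^ ((d:ℝ) / 2) : ℝ) : ℂ) * (Complex.I ^ l * ((RS α l P y : ℝ) : ℂ)) := by
  have hα0 : 0 ≤ α := by
    have : (2:ℝ) ≤ d := by exact_mod_cast hd
    rw [hα]; linarith
  induction l with
  | zero =>
    intro P hP y
    rw [← totalDegree_zero_iff_isHomogeneous, totalDegree_eq_zero_iff_eq_C] at hP
    generalize coeff 0 P = a at hP
    subst hP
    unfold SI RS
    simp only [eval_C]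
    rw [integral_const_mul, sphere_base d hd α hα y]
    simp [gg]
    ring
  | succ l ih =>
    have step : ∀ (Q : MvPolynomial (Fin d) ℝ) (_ : Q.IsHomogeneous l) (j : Fin d) (y : Ed d),
        SI (X j * Q) y = (((2 * Real.pi) ^ ((d:ℝ) / 2) : ℝ) : ℂ) *
          (Complex.I ^ (l + 1) * ((RS α (l + 1) (X j * Q) y : ℝ) : ℂ)) := by
      intro Q hQ j y
      have h1 := SI_line Q y j
      simp only [ih Q hQ] at h1
      have h2 := (((RS_line α hα0 l Q hQ y j).ofReal_comp).const_mul (Complex.I ^ l)).const_mul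
        (((2 * Real.pi) ^ ((d:ℝ) / 2) : ℝ) : ℂ)
      have h3 := h1.unique h2
      have h4 : SI (X j * Q) y = -(Complex.I * (Complex.I * SI (X j * Q) y)) := by
        rw [← mul_assoc, Complex.I_mul_I]; ring
      rw [h4, h3, pow_succ]
      push_cast
      ring
    intro P hP y
    have hE := hP.sum_X_mul_pderiv
    have hsm : ((l + 1 : ℕ) : ℝ) • P = ∑ i, X i * pderiv i P := by
      rw [hE, Nat.cast_smul_eq_nsmul]
    have hne : ((l + 1 : ℕ) : ℂ) ≠ 0 := by exact_mod_cast Nat.succ_ne_zero l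
    have e1 := SI_smul ((l + 1 : ℕ) : ℝ) P y
    have e2 := RS_smul α (l + 1) ((l + 1 : ℕ) : ℝ) P y
    rw [hsm, SI_sum] at e1
    rw [hsm, RS_sum] at e2
    have e3 : ∑ i, SI (X i * pderiv i P) y = (((2 * Real.pi) ^ ((d:ℝ) / 2) : ℝ) : ℂ) *
          (Complex.I ^ (l + 1) * ((∑ i, RS α (l + 1) (X i * pderiv i P) y : ℝ) : ℂ)) := by
      rw [Complex.ofReal_sum, Finset.mul_sum, Finset.mul_sum]
      exact Finset.sum_congr rfl fun i _ => step _ hP.pderiv i y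
    rw [e1, e2] at e3
    have hne' : (((l + 1 : ℕ) : ℝ) : ℂ) ≠ 0 := by exact_mod_cast Nat.succ_ne_zero l
    refine mul_left_cancel₀ hne' ?_
    rw [e3, Complex.ofReal_mul]
    ring

end sphereId

section final
variable {d : ℕ}

lemma hankel_eq (ν : ℝ) (hν : 0 ≤ ν) (f : ℝ → ℝ) (t : ℝ) :
    hankel ν f t = 2 ^ (-ν) *
      ∫ s in Set.Ioi (0:ℝ), f s * Gs ν ((s * t) ^ 2) * s ^ (2 * ν + 1) := by
  unfold hankel
  have hΓ : Real.Gamma (ν + 1) ≠ 0 := (Real.Gamma_pos_of_pos (by linarith)).ne'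
  have : ∀ s : ℝ, f s * sphericalBesselJ ν (s * t) * s ^ (2 * ν + 1) =
      Real.Gamma (ν + 1) * (f s * Gs ν ((s * t) ^ 2) * s ^ (2 * ν + 1)) := by
    intro s
    rw [sphericalBesselJ_eq]
    ring
  simp only [this]
  rw [integral_const_mul, ← mul_assoc, div_mul_cancel₀ _ hΓ]

lemma schwartz_pow_integrable (f : 𝓢(ℝ, ℝ)) (m : ℕ) :
    IntegrableOn (fun r : ℝ => |r| ^ m * |f r|) (Set.Ioi 0) := by
  have := f.integrable_pow_mul volume m
  simp only [Real.norm_eq_abs] at this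
  exact this.integrableOn

lemma hankel_integrable (ν : ℝ) (hν : 0 ≤ ν) (m : ℕ) (hm : 2 * ν + 1 = m) (f : 𝓢(ℝ, ℝ)) (t : ℝ) :
    IntegrableOn (fun s : ℝ => f s * Gs ν ((s * t) ^ 2) * s ^ (2 * ν + 1)) (Set.Ioi 0) := by
  have hc : Continuous (Gs ν) :=
    continuous_iff_continuousAt.mpr fun q => (hasDerivAt_Gs ν hν q).continuousAt
  have hf : Continuous fun s => f s := f.continuous
  rw [hm]
  simp only [Real.rpow_natCast]
  refine Integrable.mono' ((schwartz_pow_integrable f m).const_mul |Gs ν 0|) ?_ ?_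
  · have : Continuous fun s : ℝ => f s * Gs ν ((s * t) ^ 2) * s ^ m := by fun_prop
    exact this.aestronglyMeasurable
  · refine Filter.Eventually.of_forall fun s => ?_
    rw [Real.norm_eq_abs, abs_mul, abs_mul, abs_pow]
    have := Gs_bound ν hν ((s * t) ^ 2) (sq_nonneg _)
    calc |f s| * |Gs ν ((s * t) ^ 2)| * |s| ^ m ≤ |f s| * |Gs ν 0| * |s| ^ m := by gcongr
      _ = _ := by ring

lemma eval_bound (hd : 1 ≤ d) (l : ℕ) (P : MvPolynomial (Fin d) ℝ) (hP : P.IsHomogeneous l) :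
    ∃ B : ℝ, ∀ x : Ed d, |eval (fun i => x i) P| ≤ B * ‖x‖ ^ l := by
  obtain ⟨B, hB⟩ := (isCompact_closedBall (0 : Ed d) 1).exists_bound_of_continuousOn
    (eval_cont P).continuousOn
  refine ⟨B, fun x => ?_⟩
  have hdec : ∃ u : Ed d, ‖u‖ ≤ 1 ∧ x = ‖x‖ • u := by
    by_cases hx : x = 0
    · exact ⟨0, by simp, by simp [hx]⟩
    · have hn : ‖x‖ ≠ 0 := norm_ne_zero_iff.mpr hx
      refine ⟨‖x‖⁻¹ • x, ?_, ?_⟩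
      · rw [norm_smul, norm_inv, norm_norm, inv_mul_cancel₀ hn]
      · rw [smul_smul, mul_inv_cancel₀ hn, one_smul]
  obtain ⟨u, hu, hxu⟩ := hdec
  have h1 := eval_homog hP ‖x‖ u
  rw [← hxu] at h1
  rw [h1, abs_mul, abs_pow, abs_norm, mul_comm]
  have := hB u (by simpa using hu)
  rw [Real.norm_eq_abs] at this
  gcongr

lemma main_integrable (hd : 1 ≤ d) (l : ℕ) (P : MvPolynomial (Fin d) ℝ) (hP : P.IsHomogeneous l)
    (f : 𝓢(ℝ, ℝ)) (y : Ed d) :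
    Integrable (fun x : Ed d => ((f ‖x‖ * eval (fun i => x i) P : ℝ) : ℂ) *
            Complex.exp (Complex.I * ((⟪y, x⟫ : ℝ) : ℂ))) := by
  obtain ⟨B, hB⟩ := eval_bound hd l P hP
  refine integrable_radial hd _ ?_ (fun r => B * (|r| ^ l * |f r|)) ?_ ?_
  · have h1 := eval_cont P
    have hf : Continuous fun s => f s := f.continuous
    have h2 : Continuous fun x : Ed d => f ‖x‖ := hf.comp continuous_norm
    have h3 : Continuous fun x : Ed d => ((f ‖x‖ * eval (fun i => x i) P : ℝ) : ℂ) :=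
      Complex.continuous_ofReal.comp (h2.mul h1)
    exact h3.mul (by fun_prop)
  · intro x
    rw [norm_mul, mul_comm Complex.I, Complex.norm_exp_ofReal_mul_I, mul_one, Complex.norm_real,
      Real.norm_eq_abs, abs_mul, abs_norm]
    calc |f ‖x‖| * |eval (fun i => x i) P| ≤ |f ‖x‖| * (B * ‖x‖ ^ l) := by gcongr; exact hB x
      _ = _ := by ring
  · have hI : IntegrableOn (fun r : ℝ => B * (|r| ^ (d - 1 + l) * |f r|)) (Set.Ioi 0) :=
      (schwartz_pow_integrable f (d - 1 + l)).const_mul B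
    refine hI.congr_fun ?_ measurableSet_Ioi
    intro r hr
    have hr' : |r| = r := abs_of_pos hr
    simp only [hr', pow_add]
    ring

lemma radial_term (hd : 2 ≤ d) (α : ℝ) (hα : α = ((d:ℝ) - 2) / 2) (l : ℕ)
    (P : MvPolynomial (Fin d) ℝ) (hP : P.IsHomogeneous l) (f : ℝ → ℝ) (y : Ed d) (r : ℝ) (hr : 0 < r) :
    r ^ (d - 1) * (f r * r ^ l * RS α l P (r • y)) =
      ∑ k ∈ Finset.range (l / 2 + 1), ((-1 : ℝ) ^ k / (2 ^ k * (Nat.factorial k)) *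
        2 ^ (-(α + l - k)) * eval (fun i => y i) (lap^[k] P)) *
        (f r * Gs (α + l - k) ((r * ‖y‖) ^ 2) * r ^ (2 * (α + l - k) + 1)) := by
  unfold RS
  rw [← Finset.sum_subset (Finset.range_mono (show l / 2 + 1 ≤ l + 1 by omega))]
  · rw [Finset.mul_sum, Finset.mul_sum]
    refine Finset.sum_congr rfl fun k hk => ?_
    have hk2 : 2 * k ≤ l := by
      have := Finset.mem_range.mp hk
      omega
    have e : 2 * (α + l - k) + 1 = ((d - 1 + l + (l - 2 * k) : ℕ) : ℝ) := by
      rw [Nat.cast_add, Nat.cast_add, Nat.cast_sub hk2, Nat.cast_sub (by omega : 1 ≤ d), hα]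
      push_cast
      ring
    rw [e, Real.rpow_natCast, eval_homog (lap_iter_homog hP k) r y, gg, norm_smul,
      Real.norm_eq_abs, abs_of_pos hr, pow_add, pow_add]
    ring
  · intro k _ hk
    have : l < 2 * k := by
      have := Finset.mem_range.not.mp hk
      omega
    rw [lap_iter_zero hP k this, map_zero, mul_zero]

lemma inner_integral (P : MvPolynomial (Fin d) ℝ) (l : ℕ) (hP : P.IsHomogeneous l)
    (f : ℝ → ℝ) (y : Ed d) (r : ℝ) (hr : 0 < r) :
    ∫ ω : Metric.sphere (0 : Ed d) 1,
      ((f ‖r • (ω : Ed d)‖ * eval (fun i => (r • (ω : Ed d)) i) P : ℝ) : ℂ) *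
            Complex.exp (Complex.I * ((⟪y, r • (ω : Ed d)⟫ : ℝ) : ℂ)) ∂(sig d) =
     ((f r * r ^ l : ℝ) : ℂ) * SI P (r • y) := by
  unfold SI
  rw [← integral_const_mul]
  congr 1
  funext ω
  rw [eval_homog hP, norm_smul, sphere_norm, Real.norm_eq_abs, abs_of_pos hr, mul_one,
    inner_smul_right, real_inner_smul_left]
  push_cast
  ring

end final

/-- **Generalized Bochner identity, second form (Corollary 4).** For a homogeneous
polynomial `P` of degree `l` on `ℝ^d` (`d ≥ 3`, `α = (d-2)/2`) and a Schwartz function `f`: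
`(2π)^{-d/2} ∫_{ℝ^d} f(|x|)P(x)e^{i(y|x)} dx
  = i^l Σ_{k=0}^{⌊l/2⌋} ((-1)^k/(2^k k!)) H_{α+l-k}(f)(|y|) (Δ^k P)(y)`. -/
theorem generalized_bochner_second_form (d l : ℕ) (hd : 3 ≤ d)
    (α : ℝ) (hα : α = ((d : ℝ) - 2) / 2)
    (P : MvPolynomial (Fin d) ℝ) (hP : P.IsHomogeneous l)
    (f : 𝓢(ℝ, ℝ)) (y : EuclideanSpace ℝ (Fin d)) :
    ((2 * Real.pi : ℝ) ^ (-(d : ℝ) / 2) : ℝ) *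
        ∫ x : EuclideanSpace ℝ (Fin d),
          ((f ‖x‖ * eval (fun i => x i) P : ℝ) : ℂ) *
            Complex.exp (Complex.I * ((⟪y, x⟫ : ℝ) : ℂ)) =
      Complex.I ^ l *
        ∑ k ∈ Finset.range (l / 2 + 1),
          (((-1 : ℝ) ^ k / (2 ^ k * (Nat.factorial k)) *
              hankel (α + l - k) (fun s => f s) ‖y‖ *
              eval (fun i => y i) (lap^[k] P) : ℝ) : ℂ) := by
  have hd2 : 2 ≤ d := by omega
  have hd1 : 1 ≤ d := by omega
  have hα0 : 0 ≤ α := by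
    have : (2:ℝ) ≤ d := by exact_mod_cast hd2
    rw [hα]; linarith
  have hpos : (0:ℝ) < 2 * Real.pi := by positivity
  rw [polar d hd1 _ (main_integrable hd1 l P hP f y)]
  have h1 : ∫ r in Set.Ioi (0:ℝ), r ^ (d - 1) • ∫ ω : Metric.sphere (0 : Ed d) 1,
      ((f ‖r • (ω : Ed d)‖ * eval (fun i => (r • (ω : Ed d)) i) P : ℝ) : ℂ) *
            Complex.exp (Complex.I * ((⟪y, r • (ω : Ed d)⟫ : ℝ) : ℂ)) ∂(sig d) =
      ∫ r in Set.Ioi (0:ℝ), ((((2 * Real.pi) ^ ((d:ℝ) / 2) : ℝ) : ℂ) * Complex.I ^ l) *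
        ((∑ k ∈ Finset.range (l / 2 + 1), ((-1 : ℝ) ^ k / (2 ^ k * (Nat.factorial k)) *
        2 ^ (-(α + l - k)) * eval (fun i => y i) (lap^[k] P)) *
        (f r * Gs (α + l - k) ((r * ‖y‖) ^ 2) * r ^ (2 * (α + l - k) + 1)) : ℝ) : ℂ) := by
    refine setIntegral_congr_fun measurableSet_Ioi fun r hr => ?_
    have hr' : 0 < r := hr
    have e1 := inner_integral P l hP (fun s => f s) y r hr'
    have e2 := radial_term hd2 α hα l P hP (fun s => f s) y r hr'
    simp only at e1 e2 ⊢
    rw [e1, sphere_identity hd2 α hα l P hP, ← e2, Complex.real_smul]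
    push_cast
    ring
  rw [h1, integral_const_mul, integral_complex_ofReal]
  have hle : ∀ k ∈ Finset.range (l / 2 + 1), 2 * k ≤ l := by
    intro k hk
    have := Finset.mem_range.mp hk
    omega
  have hν : ∀ k ∈ Finset.range (l / 2 + 1), 0 ≤ α + l - k := by
    intro k hk
    have h := hle k hk
    have : (k : ℝ) ≤ l := by exact_mod_cast (by omega : k ≤ l)
    linarith
  rw [integral_finsetSum]
  · have hc : (((2 * Real.pi : ℝ) ^ (-(d : ℝ) / 2) : ℝ) : ℂ) *
        (((2 * Real.pi) ^ ((d:ℝ) / 2) : ℝ) : ℂ) = 1 := by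
      rw [← Complex.ofReal_mul, ← Real.rpow_add hpos]
      have : -(d : ℝ) / 2 + (d : ℝ) / 2 = 0 := by ring
      rw [this, Real.rpow_zero, Complex.ofReal_one]
    rw [← mul_assoc, ← mul_assoc, hc, one_mul, Complex.ofReal_sum]
    congr 1
    refine Finset.sum_congr rfl fun k hk => ?_
    rw [integral_const_mul, hankel_eq _ (hν k hk)]
    congr 1
    ring
  · intro k hk
    have hk2 := hle k hk
    refine (hankel_integrable (α + l - k) (hν k hk) (d - 1 + l + (l - 2 * k)) ?_ f ‖y‖).const_mul _
    rw [Nat.cast_add, Nat.cast_add, Nat.cast_sub hk2, Nat.cast_sub hd1, hα]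
    push_cast
    ring


end
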